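/- arXiv:0903.3330 — 4 statements merged into one kernel-verified Lean document; each statement's English description precedes it below -/
import Mathlib

section
/- Let C be a bivariate copula whose partial derivatives Ċ₁ and Ċ₂ exist everywhere on [0,1]² and take values in [0,1], and suppose C is left-tail decreasing (LTD), i.e. Ċ₁(u,v) ≤ C(u,v)/u and Ċ₂(u,v) ≤ C(u,v)/v for all u, v ∈ (0,1). Then for all u, v, s, t ∈ [0,1] one has Γ̂(u,v,s,t) ≤ Γ(u,v,s,t). -/
open Set

/-- Asymptotic covariance function of the standard empirical process based on
observations from the copula `C`: `Gamma C u v s t = C(u ∧ s, v ∧ t) - C(u,v)·C(s,t)`. -/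
noncomputable def Gamma (C : ℝ → ℝ → ℝ) (u v s t : ℝ) : ℝ :=
  C (min u s) (min v t) - C u v * C s t

/-- Asymptotic covariance function of the empirical copula process, where `C1` and `C2`
denote the partial derivatives of the copula `C`. -/
noncomputable def GammaHat (C C1 C2 : ℝ → ℝ → ℝ) (u v s t : ℝ) : ℝ :=
  Gamma C u v s t
    - C1 u v * Gamma C u 1 s t - C2 u v * Gamma C 1 v s t
    - C1 s t * Gamma C u v s 1 - C2 s t * Gamma C u v 1 t
    + C1 u v * C1 s t * Gamma C u 1 s 1
    + C1 u v * C2 s t * Gamma C u 1 1 t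
    + C2 u v * C1 s t * Gamma C 1 v s 1
    + C2 u v * C2 s t * Gamma C 1 v 1 t

/-- An affine function that is nonnegative at the endpoints of `[0, P]` is nonnegative on it. -/
theorem affine_nonneg_of_endpoints {f : ℝ → ℝ} (hf : ∀ x, f x = f 0 + (f 1 - f 0) * x)
    {p P : ℝ} (hp : 0 ≤ p) (hpP : p ≤ P) (h0 : 0 ≤ f 0) (hP : 0 ≤ f P) : 0 ≤ f p := by
  rw [hf] at hP ⊢
  rcases le_total 0 (f 1 - f 0) with hb | hb
  · nlinarith [mul_nonneg hb hp]
  · nlinarith [mul_le_mul_of_nonpos_left hpP hb]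

/-- If `x f'(x) ≤ f(x)` on `(0,1)`, then `f(x) / x` is nonincreasing, stated without division. -/
theorem mul_le_mul_of_deriv_le_div {f f' : ℝ → ℝ}
    (hd : ∀ x ∈ Icc (0 : ℝ) 1, HasDerivWithinAt f (f' x) (Icc 0 1) x)
    (hle : ∀ x ∈ Ioo (0 : ℝ) 1, f' x ≤ f x / x) (h0 : f 0 = 0)
    {x y : ℝ} (hx : 0 ≤ x) (hxy : x ≤ y) (hy : y ≤ 1) : x * f y ≤ y * f x := by
  rcases hx.eq_or_lt with rfl | hx
  · simp [h0]
  have hanti : AntitoneOn (fun z => f z / z) (Icc x y) := by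
    have hcont : ContinuousOn f (Icc x y) := fun z hz =>
      (hd z ⟨hx.le.trans hz.1, hz.2.trans hy⟩).continuousWithinAt.mono
        (Icc_subset_Icc hx.le hy)
    refine antitoneOn_of_hasDerivWithinAt_nonpos
      (f' := fun z => (f' z * z - f z * 1) / z ^ 2) (convex_Icc x y)
      (hcont.div continuousOn_id fun z hz => (hx.trans_le hz.1).ne') ?_ ?_
    · intro z hz
      rw [interior_Icc] at hz
      have hz0 : 0 < z := hx.trans hz.1
      have hz1 : z < 1 := hz.2.trans_le hy
      have hfz : HasDerivAt f (f' z) z :=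
        (hd z ⟨hz0.le, hz1.le⟩).hasDerivAt (Icc_mem_nhds hz0 hz1)
      exact (hfz.div (hasDerivAt_id z) hz0.ne').hasDerivWithinAt
    · intro z hz
      rw [interior_Icc] at hz
      have hz0 : 0 < z := hx.trans hz.1
      have := (le_div_iff₀ hz0).1 (hle z ⟨hz0, hz.2.trans_le hy⟩)
      exact div_nonpos_of_nonpos_of_nonneg (by linarith) (sq_nonneg z)
  have h := hanti (left_mem_Icc.2 hxy) (right_mem_Icc.2 hxy) hxy
  rw [div_le_div_iff₀ (hx.trans_le hxy) hx] at h
  linarith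

/-- The bound `x f'(x) ≤ f(x)` on `(0,1)` extends to the closed interval. -/
theorem mul_deriv_le_of_deriv_le_div {f f' : ℝ → ℝ}
    (hd : ∀ x ∈ Icc (0 : ℝ) 1, HasDerivWithinAt f (f' x) (Icc 0 1) x)
    (hle : ∀ x ∈ Ioo (0 : ℝ) 1, f' x ≤ f x / x) (h0 : f 0 = 0)
    {x : ℝ} (hx : x ∈ Icc (0 : ℝ) 1) : x * f' x ≤ f x := by
  rcases hx.1.eq_or_lt with rfl | hx0
  · simp [h0]
  rcases hx.2.eq_or_lt with rfl | hx1
  · rw [one_mul]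
    have hslope := (hasDerivWithinAt_iff_tendsto_slope.1 (hd 1 hx))
    rw [Icc_sdiff_right] at hslope
    have : (nhdsWithin (1 : ℝ) (Ico 0 1)).NeBot := by
      rw [nhdsWithin_Ico_eq_nhdsLT zero_lt_one]; infer_instance
    refine le_of_tendsto hslope ?_
    filter_upwards [self_mem_nhdsWithin] with z hz
    have hmul := mul_le_mul_of_deriv_le_div hd hle h0 hz.1 hz.2.le le_rfl
    rw [slope_comm, slope_def_field, div_le_iff₀ (by linarith [hz.2])]
    linarith
  · have := (le_div_iff₀ hx0).1 (hle x ⟨hx0, hx1⟩)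
    linarith

/-- The left-tail decreasing inequality also holds on the edges `y = 0` and `y = 1`. -/
theorem deriv_le_div_of_boundary {K K' : ℝ → ℝ → ℝ}
    (hd : ∀ x ∈ Icc (0 : ℝ) 1, ∀ y ∈ Icc (0 : ℝ) 1,
      HasDerivWithinAt (fun z => K z y) (K' x y) (Icc 0 1) x)
    (hbot : ∀ x ∈ Icc (0 : ℝ) 1, K x 0 = 0) (htop : ∀ x ∈ Icc (0 : ℝ) 1, K x 1 = x)
    (hle : ∀ x ∈ Icc (0 : ℝ) 1, ∀ y ∈ Icc (0 : ℝ) 1, K' x y ≤ 1)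
    (hltd : ∀ x ∈ Ioo (0 : ℝ) 1, ∀ y ∈ Ioo (0 : ℝ) 1, K' x y ≤ K x y / x)
    {y : ℝ} (hy : y ∈ Icc (0 : ℝ) 1) : ∀ x ∈ Ioo (0 : ℝ) 1, K' x y ≤ K x y / x := by
  intro x hx
  have hx' := Ioo_subset_Icc_self hx
  rcases hy.1.eq_or_lt with rfl | hy0
  · have hconst : HasDerivWithinAt (fun z => K z 0) 0 (Icc 0 1) x :=
      (hasDerivWithinAt_const x (Icc (0 : ℝ) 1) (0 : ℝ)).congr hbot (hbot x hx')
    rw [(uniqueDiffOn_Icc zero_lt_one x hx').eq_deriv _ (hd x hx' 0 hy) hconst, hbot x hx',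
      zero_div]
  rcases hy.2.eq_or_lt with rfl | hy1
  · rw [htop x hx', div_self hx.1.ne']
    exact hle x hx' 1 hy
  · exact hltd x hx y ⟨hy0, hy1⟩

theorem Gamma_comm (C : ℝ → ℝ → ℝ) (u v s t : ℝ) : Gamma C u v s t = Gamma C s t u v := by
  simp only [Gamma, min_comm u s, min_comm v t, mul_comm (C u v)]

theorem GammaHat_comm (C C1 C2 : ℝ → ℝ → ℝ) (u v s t : ℝ) :
    GammaHat C C1 C2 u v s t = GammaHat C C1 C2 s t u v := by
  simp only [GammaHat, Gamma_comm C s t, Gamma_comm C s 1, Gamma_comm C 1 t]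
  ring

/-- Here `a, b, c, d` stand for `C(u,v), C(s,t), C(u,t), C(s,v)`, with `(u,v) ≤ (s,t)`. -/
theorem covariance_correction_le_of_concordant {u v s t a b c d p₁ p₂ q₁ q₂ : ℝ}
    (hu : 0 ≤ u) (hv : 0 ≤ v) (hs1 : s ≤ 1) (ht1 : t ≤ 1)
    (hp₁ : 0 ≤ p₁) (hp₂ : 0 ≤ p₂) (hq₁ : q₁ ∈ Icc (0 : ℝ) 1) (hq₂ : q₂ ∈ Icc (0 : ℝ) 1)
    (hbs : b ≤ s) (hbt : b ≤ t) (hup : u * p₁ ≤ a) (hvp : v * p₂ ≤ a)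
    (huc : u * b ≤ c) (hvd : v * b ≤ d) :
    p₁ * q₁ * (u * (1 - s)) + p₁ * q₂ * (c - u * t) + p₂ * q₁ * (d - s * v)
        + p₂ * q₂ * (v * (1 - t))
      ≤ p₁ * (c - u * b) + p₂ * (d - v * b) + q₁ * (a * (1 - s)) + q₂ * (a * (1 - t)) := by
  have h₁ : q₁ * (1 - s) * (u * p₁) ≤ q₁ * (1 - s) * a :=
    mul_le_mul_of_nonneg_left hup (mul_nonneg hq₁.1 (by linarith))
  have h₂ : q₂ * (1 - t) * (v * p₂) ≤ q₂ * (1 - t) * a :=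
    mul_le_mul_of_nonneg_left hvp (mul_nonneg hq₂.1 (by linarith))
  have h₃ : 0 ≤ p₁ * ((1 - q₂) * (c - u * b) + q₂ * u * (t - b)) :=
    mul_nonneg hp₁ (add_nonneg (mul_nonneg (by linarith [hq₂.2]) (by linarith))
      (mul_nonneg (mul_nonneg hq₂.1 hu) (by linarith)))
  have h₄ : 0 ≤ p₂ * ((1 - q₁) * (d - v * b) + q₁ * v * (s - b)) :=
    mul_nonneg hp₂ (add_nonneg (mul_nonneg (by linarith [hq₁.2]) (by linarith))
      (mul_nonneg (mul_nonneg hq₁.1 hv) (by linarith)))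
  linarith

/-- Here `a, b, c, d` stand for `C(u,v), C(s,t), C(u,t), C(s,v)`, with `u ≤ s` and `t ≤ v`. -/
theorem covariance_correction_le_of_discordant {u v s t a b c d p₁ p₂ q₁ q₂ : ℝ}
    (hu : 0 ≤ u) (ht : 0 ≤ t) (hus : u ≤ s) (htv : t ≤ v) (hs1 : s ≤ 1) (hv1 : v ≤ 1)
    (hp₁ : 0 ≤ p₁) (hp₂ : 0 ≤ p₂) (hq₁ : 0 ≤ q₁) (hq₂ : 0 ≤ q₂)
    (hup : u * p₁ ≤ a) (hvp : v * p₂ ≤ a) (hsq : s * q₁ ≤ b) (htq : t * q₂ ≤ b)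
    (ha : 0 ≤ a) (hb : 0 ≤ b) (hc : 0 ≤ c) (hau : a ≤ u) (hbt : b ≤ t)
    (hcu : c ≤ u) (hct : c ≤ t)
    (hds : d ≤ s) (hdv : d ≤ v) (hac : t * a ≤ v * c) (hbc : u * b ≤ s * c) :
    p₁ * q₁ * (u * (1 - s)) + p₁ * q₂ * (c - u * t) + p₂ * q₁ * (d - s * v)
        + p₂ * q₂ * (t * (1 - v))
      ≤ p₁ * (c - u * b) + p₂ * (b * (1 - v)) + q₁ * (a * (1 - s)) + q₂ * (c - t * a) := by
  rcases hu.eq_or_lt with rfl | hu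
  · obtain rfl : a = 0 := le_antisymm hau ha
    obtain rfl : c = 0 := le_antisymm hcu hc
    rcases (ht.trans htv).eq_or_lt with rfl | hv
    · obtain rfl : t = 0 := le_antisymm htv ht
      nlinarith [mul_nonneg hp₂ hb, mul_le_mul_of_nonneg_left hdv (mul_nonneg hp₂ hq₁)]
    · obtain rfl : p₂ = 0 := le_antisymm (nonpos_of_mul_nonpos_right hvp hv) hp₂
      simp
  rcases ht.eq_or_lt with rfl | ht
  · obtain rfl : b = 0 := le_antisymm hbt hb
    obtain rfl : c = 0 := le_antisymm hct hc
    obtain rfl : q₁ = 0 :=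
      le_antisymm (nonpos_of_mul_nonpos_right hsq (hu.trans_le hus)) hq₁
    simp
  have hs : 0 < s := hu.trans_le hus
  have hv : 0 < v := ht.trans_le htv
  have huc : u * b ≤ c := hbc.trans (by nlinarith)
  have htc : t * a ≤ c := hac.trans (by nlinarith)
  have hA {y : ℝ} (hy0 : 0 ≤ y) (hy1 : y ≤ 1) : y * (c - u * t) ≤ c - u * b := by
    nlinarith [mul_nonneg (sub_nonneg.2 hy1) (sub_nonneg.2 huc),
      mul_nonneg (mul_nonneg hy0 hu.le) (sub_nonneg.2 hbt)]
  have hB₂ {y : ℝ} (hy : t * y ≤ b) : y * (t * (1 - v)) ≤ b * (1 - v) := by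
    nlinarith [mul_le_mul_of_nonneg_right hy (sub_nonneg.2 hv1)]
  have hB₁ : q₁ * (d - s * v) ≤ b * (1 - v) := by
    nlinarith [mul_le_mul_of_nonneg_right hsq (sub_nonneg.2 hv1),
      mul_le_mul_of_nonneg_left hds hq₁]
  have hD₁ {x : ℝ} (hx : u * x ≤ a) : x * (u * (1 - s)) ≤ a * (1 - s) := by
    nlinarith [mul_le_mul_of_nonneg_right hx (sub_nonneg.2 hs1)]
  have hD₂ : p₂ * (d - s * v) ≤ a * (1 - s) := by
    nlinarith [mul_le_mul_of_nonneg_right hvp (sub_nonneg.2 hs1),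
      mul_le_mul_of_nonneg_left hdv hp₂]
  have hE : 0 ≤ c - t * a := sub_nonneg.2 htc
  -- The extreme values of `p₁, p₂, q₁, q₂`; the difference of the sides is affine in each.
  obtain ⟨x₁, hx₁⟩ : ∃ x, u * x = a := ⟨a / u, mul_div_cancel₀ a hu.ne'⟩
  obtain ⟨x₂, hx₂⟩ : ∃ x, v * x = a := ⟨a / v, mul_div_cancel₀ a hv.ne'⟩
  obtain ⟨y₁, hy₁⟩ : ∃ x, s * x = b := ⟨b / s, mul_div_cancel₀ b hs.ne'⟩
  obtain ⟨y₂, hy₂⟩ : ∃ x, t * x = b := ⟨b / t, mul_div_cancel₀ b ht.ne'⟩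
  have hx₁0 : 0 ≤ x₁ := nonneg_of_mul_nonneg_right (hx₁ ▸ ha) hu
  have hx₂0 : 0 ≤ x₂ := nonneg_of_mul_nonneg_right (hx₂ ▸ ha) hv
  have hy₁0 : 0 ≤ y₁ := nonneg_of_mul_nonneg_right (hy₁ ▸ hb) hs
  have hy₂0 : 0 ≤ y₂ := nonneg_of_mul_nonneg_right (hy₂ ▸ hb) ht
  have hy₂1 : y₂ ≤ 1 := le_of_mul_le_mul_left (by linarith) ht
  have hpx₁ : p₁ ≤ x₁ := le_of_mul_le_mul_left (by linarith) hu
  have hpx₂ : p₂ ≤ x₂ := le_of_mul_le_mul_left (by linarith) hv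
  have hqy₁ : q₁ ≤ y₁ := le_of_mul_le_mul_left (by linarith) hs
  have hqy₂ : q₂ ≤ y₂ := le_of_mul_le_mul_left (by linarith) ht
  have hfull : x₂ * y₁ * d ≤ y₂ * c := by
    have h₁ : t * x₂ ≤ c := le_of_mul_le_mul_left (by linear_combination hac + t * hx₂) hv
    have h₂ : y₁ * d ≤ b := by linarith [mul_le_mul_of_nonneg_left hds hy₁0]
    have h₃ : (t * x₂) * (y₁ * d) ≤ c * b :=
      (mul_le_mul_of_nonneg_left h₂ (mul_nonneg ht.le hx₂0)).trans
        (mul_le_mul_of_nonneg_right h₁ hb)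
    exact le_of_mul_le_mul_left (by linear_combination h₃ - c * hy₂) ht
  have hcorner : 0 ≤ x₁ * c * (1 - y₂) :=
    mul_nonneg (mul_nonneg hx₁0 hc) (sub_nonneg.2 hy₂1)
  let F (p₁ p₂ q₁ q₂ : ℝ) : ℝ :=
    p₁ * (c - u * b) + p₂ * (b * (1 - v)) + q₁ * (a * (1 - s)) + q₂ * (c - t * a)
      - (p₁ * q₁ * (u * (1 - s)) + p₁ * q₂ * (c - u * t) + p₂ * q₁ * (d - s * v)
        + p₂ * q₂ * (t * (1 - v)))
  have hF₄ : 0 ≤ F x₁ x₂ y₁ y₂ := by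
    have h : F x₁ x₂ y₁ y₂ = x₁ * c * (1 - y₂) + (y₂ * c - x₂ * y₁ * d) := by
      simp only [F]
      linear_combination (y₂ * t - b - y₁ * (1 - s)) * hx₁ + y₁ * s * hx₂ + a * hy₁
        - x₂ * (1 - v) * hy₂
    linarith
  have hF₃ : 0 ≤ F x₁ x₂ q₁ y₂ := by
    refine affine_nonneg_of_endpoints (f := fun z => F x₁ x₂ z y₂)
      (fun z => by simp only [F]; ring) hq₁ hqy₁ ?_ hF₄
    simp only [F]
    linarith [mul_le_mul_of_nonneg_left (hA hy₂0 hy₂1) hx₁0,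
      mul_le_mul_of_nonneg_left (hB₂ hy₂.le) hx₂0, mul_nonneg hy₂0 hE]
  have hF₂ : 0 ≤ F x₁ p₂ q₁ y₂ := by
    refine affine_nonneg_of_endpoints (f := fun z => F x₁ z q₁ y₂)
      (fun z => by simp only [F]; ring) hp₂ hpx₂ ?_ hF₃
    simp only [F]
    linarith [mul_le_mul_of_nonneg_left (hA hy₂0 hy₂1) hx₁0,
      mul_le_mul_of_nonneg_left (hD₁ hx₁.le) hq₁, mul_nonneg hy₂0 hE]
  have hF₁ : 0 ≤ F x₁ p₂ q₁ q₂ := by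
    refine affine_nonneg_of_endpoints (f := fun z => F x₁ p₂ q₁ z)
      (fun z => by simp only [F]; ring) hq₂ hqy₂ ?_ hF₂
    simp only [F]
    linarith [mul_le_mul_of_nonneg_left hB₁ hp₂, mul_nonneg hx₁0 (sub_nonneg.2 huc),
      mul_le_mul_of_nonneg_left (hD₁ hx₁.le) hq₁]
  have hF : 0 ≤ F p₁ p₂ q₁ q₂ := by
    refine affine_nonneg_of_endpoints (f := fun z => F z p₂ q₁ q₂)
      (fun z => by simp only [F]; ring) hp₁ hpx₁ ?_ hF₁
    simp only [F]
    linarith [mul_le_mul_of_nonneg_left (hB₂ htq) hp₂, mul_nonneg hq₂ hE,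
      mul_le_mul_of_nonneg_left hD₂ hq₁]
  exact sub_nonneg.1 hF

/-- **Proposition 1 (Genest–Segers).** If `C` is a left-tail decreasing bivariate copula whose
partial derivatives `C1`, `C2` exist everywhere on `[0,1]²` and take values in `[0,1]`, then
the asymptotic covariance function of the empirical copula process is dominated by that of
the standard empirical process: `GammaHat u v s t ≤ Gamma u v s t` for all `u,v,s,t ∈ [0,1]`. -/
theorem empirical_copula_covariance_le_of_LTD (C C1 C2 : ℝ → ℝ → ℝ)
    (hbot : ∀ u ∈ Icc (0:ℝ) 1, C u 0 = 0)
    (hbot' : ∀ v ∈ Icc (0:ℝ) 1, C 0 v = 0)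
    (htop : ∀ u ∈ Icc (0:ℝ) 1, C u 1 = u)
    (htop' : ∀ v ∈ Icc (0:ℝ) 1, C 1 v = v)
    (hinc : ∀ u s v t : ℝ, 0 ≤ u → u ≤ s → s ≤ 1 → 0 ≤ v → v ≤ t → t ≤ 1 →
      0 ≤ C s t - C s v - C u t + C u v)
    (hd1 : ∀ u ∈ Icc (0:ℝ) 1, ∀ v ∈ Icc (0:ℝ) 1,
      HasDerivWithinAt (fun x => C x v) (C1 u v) (Icc 0 1) u)
    (hd2 : ∀ u ∈ Icc (0:ℝ) 1, ∀ v ∈ Icc (0:ℝ) 1,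
      HasDerivWithinAt (fun y => C u y) (C2 u v) (Icc 0 1) v)
    (hr1 : ∀ u ∈ Icc (0:ℝ) 1, ∀ v ∈ Icc (0:ℝ) 1, C1 u v ∈ Icc (0:ℝ) 1)
    (hr2 : ∀ u ∈ Icc (0:ℝ) 1, ∀ v ∈ Icc (0:ℝ) 1, C2 u v ∈ Icc (0:ℝ) 1)
    (hltd1 : ∀ u ∈ Ioo (0:ℝ) 1, ∀ v ∈ Ioo (0:ℝ) 1, C1 u v ≤ C u v / u)
    (hltd2 : ∀ u ∈ Ioo (0:ℝ) 1, ∀ v ∈ Ioo (0:ℝ) 1, C2 u v ≤ C u v / v) :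
    ∀ u ∈ Icc (0:ℝ) 1, ∀ v ∈ Icc (0:ℝ) 1, ∀ s ∈ Icc (0:ℝ) 1, ∀ t ∈ Icc (0:ℝ) 1,
      GammaHat C C1 C2 u v s t ≤ Gamma C u v s t := by
  intro u hu v hv s hs t ht
  have key : ∀ u ∈ Icc (0:ℝ) 1, ∀ v ∈ Icc (0:ℝ) 1, ∀ s ∈ Icc (0:ℝ) 1, ∀ t ∈ Icc (0:ℝ) 1,
      u ≤ s → GammaHat C C1 C2 u v s t ≤ Gamma C u v s t := by
    intro u hu v hv s hs t ht hus
    have h1 : (1 : ℝ) ∈ Icc (0 : ℝ) 1 := right_mem_Icc.2 zero_le_one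
    have h0 : (0 : ℝ) ∈ Icc (0 : ℝ) 1 := left_mem_Icc.2 zero_le_one
    have hnonneg {x y : ℝ} (hx : x ∈ Icc (0 : ℝ) 1) (hy : y ∈ Icc (0 : ℝ) 1) : 0 ≤ C x y := by
      have := hinc 0 x 0 y le_rfl hx.1 hx.2 le_rfl hy.1 hy.2
      linarith [hbot x hx, hbot' y hy, hbot 0 h0]
    have hmono₁ {x x' y : ℝ} (hx : x ∈ Icc (0 : ℝ) 1) (hx' : x' ∈ Icc (0 : ℝ) 1)
        (hy : y ∈ Icc (0 : ℝ) 1) (hxx' : x ≤ x') : C x y ≤ C x' y := by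
      have := hinc x x' 0 y hx.1 hxx' hx'.2 le_rfl hy.1 hy.2
      linarith [hbot x hx, hbot x' hx']
    have hmono₂ {x y y' : ℝ} (hx : x ∈ Icc (0 : ℝ) 1) (hy : y ∈ Icc (0 : ℝ) 1)
        (hy' : y' ∈ Icc (0 : ℝ) 1) (hyy' : y ≤ y') : C x y ≤ C x y' := by
      have := hinc 0 x y y' le_rfl hx.1 hx.2 hy.1 hyy' hy'.2
      linarith [hbot' y hy, hbot' y' hy']
    have hle₁ {x y : ℝ} (hx : x ∈ Icc (0 : ℝ) 1) (hy : y ∈ Icc (0 : ℝ) 1) : C x y ≤ x :=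
      (hmono₂ hx hy h1 hy.2).trans_eq (htop x hx)
    have hle₂ {x y : ℝ} (hx : x ∈ Icc (0 : ℝ) 1) (hy : y ∈ Icc (0 : ℝ) 1) : C x y ≤ y :=
      (hmono₁ hx h1 hy hx.2).trans_eq (htop' y hy)
    have hltd₁' {y : ℝ} (hy : y ∈ Icc (0 : ℝ) 1) : ∀ x ∈ Ioo (0 : ℝ) 1, C1 x y ≤ C x y / x :=
      deriv_le_div_of_boundary hd1 hbot htop (fun x hx y hy => (hr1 x hx y hy).2) hltd1 hy
    have hltd₂' {x : ℝ} (hx : x ∈ Icc (0 : ℝ) 1) : ∀ y ∈ Ioo (0 : ℝ) 1, C2 x y ≤ C x y / y :=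
      deriv_le_div_of_boundary (K := fun y x => C x y) (K' := fun y x => C2 x y)
        (fun y hy x hx => hd2 x hx y hy) hbot' htop' (fun y hy x hx => (hr2 x hx y hy).2)
        (fun y hy x hx => hltd2 x hx y hy) hx
    have hderiv₁ {x y : ℝ} (hx : x ∈ Icc (0 : ℝ) 1) (hy : y ∈ Icc (0 : ℝ) 1) :
        x * C1 x y ≤ C x y :=
      mul_deriv_le_of_deriv_le_div (fun z hz => hd1 z hz y hy) (hltd₁' hy) (hbot' y hy) hx
    have hderiv₂ {x y : ℝ} (hx : x ∈ Icc (0 : ℝ) 1) (hy : y ∈ Icc (0 : ℝ) 1) :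
        y * C2 x y ≤ C x y :=
      mul_deriv_le_of_deriv_le_div (hd2 x hx) (hltd₂' hx) (hbot x hx) hy
    have hratio₁ {x x' y : ℝ} (hx : 0 ≤ x) (hxx' : x ≤ x') (hx' : x' ≤ 1)
        (hy : y ∈ Icc (0 : ℝ) 1) : x * C x' y ≤ x' * C x y :=
      mul_le_mul_of_deriv_le_div (fun z hz => hd1 z hz y hy) (hltd₁' hy) (hbot' y hy) hx hxx' hx'
    have hratio₂ {x y y' : ℝ} (hx : x ∈ Icc (0 : ℝ) 1) (hy : 0 ≤ y) (hyy' : y ≤ y')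
        (hy' : y' ≤ 1) : y * C x y' ≤ y' * C x y :=
      mul_le_mul_of_deriv_le_div (hd2 x hx) (hltd₂' hx) (hbot x hx) hy hyy' hy'
    have hp₁ := hr1 u hu v hv
    have hp₂ := hr2 u hu v hv
    have hq₁ := hr1 s hs t ht
    have hq₂ := hr2 s hs t ht
    simp only [GammaHat, Gamma, min_eq_left hus, min_eq_left hu.2, min_eq_right hs.2,
      min_eq_left hv.2, min_eq_right ht.2, min_self]
    rcases le_total v t with hvt | htv
    · have huc : u * C s t ≤ C u t := (hratio₁ hu.1 hus hs.2 ht).trans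
        (mul_le_of_le_one_left (hnonneg hu ht) hs.2)
      have hvd : v * C s t ≤ C s v := (hratio₂ hs hv.1 hvt ht.2).trans
        (mul_le_of_le_one_left (hnonneg hs hv) ht.2)
      have := covariance_correction_le_of_concordant hu.1 hv.1 hs.2 ht.2 hp₁.1 hp₂.1 hq₁ hq₂
        (hle₁ hs ht) (hle₂ hs ht) (hderiv₁ hu hv) (hderiv₂ hu hv) huc hvd
      simp only [min_eq_left hvt, htop u hu, htop s hs, htop' v hv, htop' t ht]
      linarith
    · have := covariance_correction_le_of_discordant hu.1 ht.1 hus htv hs.2 hv.2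
        hp₁.1 hp₂.1 hq₁.1 hq₂.1 (hderiv₁ hu hv) (hderiv₂ hu hv) (hderiv₁ hs ht) (hderiv₂ hs ht)
        (hnonneg hu hv) (hnonneg hs ht) (hnonneg hu ht) (hle₁ hu hv) (hle₂ hs ht)
        (hle₁ hu ht) (hle₂ hu ht) (hle₁ hs hv) (hle₂ hs hv)
        (hratio₂ hu ht.1 htv hv.2) (hratio₁ hu.1 hus hs.2 ht)
      simp only [min_eq_right htv, htop u hu, htop s hs, htop' v hv, htop' t ht]
      linarith
  rcases le_total u s with hus | hsu
  · exact key u hu v hv s hs t ht hus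
  · rw [GammaHat_comm, Gamma_comm]
    exact key s hs t ht u hu v hv hsu
end

section
/- Let C be a bivariate copula whose partial derivatives Ċ₁ and Ċ₂ exist everywhere on [0,1]² and take values in [0,1]. Suppose C is negative quadrant dependent (NQD), i.e. C(u,v) ≤ uv for all u, v ∈ [0,1], and that Ċ₁(u,v) ≤ 2·C(u,v)/u and Ċ₂(u,v) ≤ 2·C(u,v)/v for all u, v ∈ (0,1). Then for all u, v ∈ [0,1] one has Γ̂(u,v,u,v) ≤ Γ(u,v,u,v). -/
open Set

/-- If `C` is grounded, `C u 1 = u`, and the partial derivative `C1` in `u` satisfies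
`C1 u v ≤ 2 * C u v / u` on the open unit square, then the contribution of `C1` alone to
`GammaHat - Gamma` is nonpositive on the closed unit square. -/
lemma partial_deriv_contribution_nonpos {C C1 : ℝ → ℝ → ℝ}
    (hbot : ∀ u ∈ Icc (0:ℝ) 1, C u 0 = 0)
    (hbot' : ∀ v ∈ Icc (0:ℝ) 1, C 0 v = 0)
    (htop : ∀ u ∈ Icc (0:ℝ) 1, C u 1 = u)
    (hd : ∀ u ∈ Icc (0:ℝ) 1, ∀ v ∈ Icc (0:ℝ) 1,
      HasDerivWithinAt (fun x => C x v) (C1 u v) (Icc 0 1) u)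
    (hr : ∀ u ∈ Icc (0:ℝ) 1, ∀ v ∈ Icc (0:ℝ) 1, C1 u v ∈ Icc (0:ℝ) 1)
    (hg : ∀ u ∈ Ioo (0:ℝ) 1, ∀ v ∈ Ioo (0:ℝ) 1, C1 u v ≤ 2 * C u v / u)
    {u v : ℝ} (hu : u ∈ Icc (0:ℝ) 1) (hv : v ∈ Icc (0:ℝ) 1) :
    C1 u v * (1 - u) * (C1 u v * u - 2 * C u v) ≤ 0 := by
  obtain ⟨h0, h1⟩ := hr u hu v hv
  rcases hu.1.eq_or_lt with rfl | hu0
  · simp [hbot' v hv]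
  rcases hu.2.eq_or_lt with rfl | hu1
  · simp
  refine mul_nonpos_of_nonneg_of_nonpos (mul_nonneg h0 (by linarith)) ?_
  rcases hv.1.eq_or_lt with rfl | hv0
  · have hz : HasDerivWithinAt (fun x => C x 0) 0 (Icc 0 1) u :=
      (hasDerivWithinAt_const u (Icc (0:ℝ) 1) (0:ℝ)).congr hbot (hbot u hu)
    have : C1 u 0 = 0 :=
      (uniqueDiffOn_Icc one_pos u hu).eq_deriv _ (hd u hu 0 hv) hz
    simp [this, hbot u hu]
  rcases hv.2.eq_or_lt with rfl | hv1
  · rw [htop u hu]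
    nlinarith
  · have := (le_div_iff₀ hu0).1 (hg u ⟨hu0, hu1⟩ v ⟨hv0, hv1⟩)
    linarith

/-- **Proposition 2 (Genest–Segers).** If `C` is a negative quadrant dependent bivariate copula
whose partial derivatives exist everywhere on `[0,1]²` with values in `[0,1]` and satisfy
`C1 u v ≤ 2·C(u,v)/u` and `C2 u v ≤ 2·C(u,v)/v` on `(0,1)²`, then the asymptotic variance of
the empirical copula process is dominated by that of the standard empirical process. -/
theorem empirical_copula_variance_le_of_NQD (C C1 C2 : ℝ → ℝ → ℝ)
    (hbot : ∀ u ∈ Icc (0:ℝ) 1, C u 0 = 0)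
    (hbot' : ∀ v ∈ Icc (0:ℝ) 1, C 0 v = 0)
    (htop : ∀ u ∈ Icc (0:ℝ) 1, C u 1 = u)
    (htop' : ∀ v ∈ Icc (0:ℝ) 1, C 1 v = v)
    (hinc : ∀ u s v t : ℝ, 0 ≤ u → u ≤ s → s ≤ 1 → 0 ≤ v → v ≤ t → t ≤ 1 →
      0 ≤ C s t - C s v - C u t + C u v)
    (hd1 : ∀ u ∈ Icc (0:ℝ) 1, ∀ v ∈ Icc (0:ℝ) 1,
      HasDerivWithinAt (fun x => C x v) (C1 u v) (Icc 0 1) u)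
    (hd2 : ∀ u ∈ Icc (0:ℝ) 1, ∀ v ∈ Icc (0:ℝ) 1,
      HasDerivWithinAt (fun y => C u y) (C2 u v) (Icc 0 1) v)
    (hr1 : ∀ u ∈ Icc (0:ℝ) 1, ∀ v ∈ Icc (0:ℝ) 1, C1 u v ∈ Icc (0:ℝ) 1)
    (hr2 : ∀ u ∈ Icc (0:ℝ) 1, ∀ v ∈ Icc (0:ℝ) 1, C2 u v ∈ Icc (0:ℝ) 1)
    (hnqd : ∀ u ∈ Icc (0:ℝ) 1, ∀ v ∈ Icc (0:ℝ) 1, C u v ≤ u * v)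
    (hg1 : ∀ u ∈ Ioo (0:ℝ) 1, ∀ v ∈ Ioo (0:ℝ) 1, C1 u v ≤ 2 * C u v / u)
    (hg2 : ∀ u ∈ Ioo (0:ℝ) 1, ∀ v ∈ Ioo (0:ℝ) 1, C2 u v ≤ 2 * C u v / v) :
    ∀ u ∈ Icc (0:ℝ) 1, ∀ v ∈ Icc (0:ℝ) 1,
      GammaHat C C1 C2 u v u v ≤ Gamma C u v u v := by
  intro u hu v hv
  have e1 := partial_deriv_contribution_nonpos hbot hbot' htop hd1 hr1 hg1 hu hv
  have e2 := partial_deriv_contribution_nonpos (C := fun y x => C x y) (C1 := fun y x => C2 x y)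
    hbot' hbot htop' (fun y hy x hx => hd2 x hx y hy) (fun y hy x hx => hr2 x hx y hy)
    (fun y hy x hx => hg2 x hx y hy) hv hu
  have e3 : C1 u v * C2 u v * (C u v - u * v) ≤ 0 :=
    mul_nonpos_of_nonneg_of_nonpos (mul_nonneg (hr1 u hu v hv).1 (hr2 u hu v hv).1)
      (sub_nonpos.2 (hnqd u hu v hv))
  simp only [GammaHat, Gamma, min_self, min_eq_left hu.2, min_eq_right hu.2, min_eq_left hv.2,
    min_eq_right hv.2, htop u hu, htop' v hv]
  linarith
end

section
/- Fix an integer d ≥ 2. For u, v ∈ (0,1]^d, define Γ_d(u,v) = π(u∧v) − π(u)π(v) and Γ̂_d(u,v) = Γ_d(u,v) − Σ_{k=1}^d π̇_k(u) Γ_d(û_k, v) − Σ_{k=1}^d π̇_k(v) Γ_d(u, v̂_k) + Σ_{k=1}^d Σ_{ℓ=1}^d π̇_k(u) π̇_ℓ(v) Γ_d(û_k, v̂_ℓ). Then for all u, v ∈ (0,1]^d, Γ̂_d(u,v) − Γ_d(u,v) = − π(u)π(v) Σ_{k=1}^d (u_k ∧ v_k − u_k v_k)/(u_k v_k), and in particular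 Γ̂_d(u,v) ≤ Γ_d(u,v). -/
open Set

/-- The independence (product) copula `piProd u = u 0 * ⋯ * u (d-1)`. -/
noncomputable def piProd {d : ℕ} (u : Fin d → ℝ) : ℝ := ∏ i, u i

/-- The partial derivative of the product copula: `piDot u k = ∏_{j ≠ k} u j`. -/
noncomputable def piDot {d : ℕ} (u : Fin d → ℝ) (k : Fin d) : ℝ :=
  ∏ j ∈ Finset.univ.erase k, u j

/-- `hatVec u k`: the vector whose `k`-th coordinate is `u k` and all others equal `1`. -/
def hatVec {d : ℕ} (u : Fin d → ℝ) (k : Fin d) : Fin d → ℝ :=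
  fun j => if j = k then u k else 1

/-- Covariance function of the `d`-variate pinned `π`-Brownian sheet:
`GammaD u v = piProd (u ∧ v) - piProd u * piProd v` with componentwise minimum. -/
noncomputable def GammaD {d : ℕ} (u v : Fin d → ℝ) : ℝ :=
  piProd (fun i => min (u i) (v i)) - piProd u * piProd v

/-- Covariance function of the limiting empirical copula process at independence. -/
noncomputable def GammaHatD {d : ℕ} (u v : Fin d → ℝ) : ℝ :=
  GammaD u v - ∑ k, piDot u k * GammaD (hatVec u k) v
    - ∑ k, piDot v k * GammaD u (hatVec v k)
    + ∑ k, ∑ l, piDot u k * piDot v l * GammaD (hatVec u k) (hatVec v l)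

theorem piProd_hatVec {d : ℕ} (u : Fin d → ℝ) (k : Fin d) : piProd (hatVec u k) = u k := by
  simp [piProd, hatVec]

theorem mul_piDot {d : ℕ} (u : Fin d → ℝ) (k : Fin d) : u k * piDot u k = piProd u :=
  Finset.mul_prod_erase Finset.univ u (Finset.mem_univ k)

theorem piDot_hatVec_self {d : ℕ} (u : Fin d → ℝ) (k : Fin d) : piDot (hatVec u k) k = 1 :=
  Finset.prod_eq_one fun _ hj => if_neg (Finset.ne_of_mem_erase hj)

theorem piDot_nonneg {d : ℕ} {u : Fin d → ℝ} (hu : ∀ i, 0 ≤ u i) (k : Fin d) :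
    0 ≤ piDot u k :=
  Finset.prod_nonneg fun j _ => hu j

theorem hatVec_le_one {d : ℕ} {u : Fin d → ℝ} (hu : ∀ i, u i ≤ 1) (k j : Fin d) :
    hatVec u k j ≤ 1 := by
  unfold hatVec
  split_ifs
  · exact hu k
  · exact le_rfl

theorem GammaD_comm {d : ℕ} (u v : Fin d → ℝ) : GammaD u v = GammaD v u := by
  simp only [GammaD, min_comm, mul_comm]

theorem GammaD_hatVec_left {d : ℕ} (u : Fin d → ℝ) {v : Fin d → ℝ} (hv : ∀ i, v i ≤ 1)
    (k : Fin d) :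
    GammaD (hatVec u k) v = piDot v k * (min (u k) (v k) - u k * v k) := by
  have hmin : piProd (fun i => min (hatVec u k i) (v i)) = min (u k) (v k) * piDot v k := by
    rw [← mul_piDot _ k]
    congr 1
    · simp [hatVec]
    · refine Finset.prod_congr rfl fun j hj => ?_
      simp [hatVec, Finset.ne_of_mem_erase hj, hv j]
  rw [GammaD, hmin, piProd_hatVec, ← mul_piDot v k]
  ring

theorem GammaD_hatVec_hatVec {d : ℕ} {u v : Fin d → ℝ} (hu : ∀ i, u i ≤ 1)
    (hv : ∀ i, v i ≤ 1) (k l : Fin d) :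
    GammaD (hatVec u k) (hatVec v l) =
      if k = l then min (u k) (v k) - u k * v k else 0 := by
  rw [GammaD_hatVec_left u (hatVec_le_one hv l)]
  split_ifs with h
  · subst h
    rw [piDot_hatVec_self]
    simp [hatVec]
  · simp [hatVec, h, hu k]

theorem GammaHatD_sub_GammaD {d : ℕ} {u v : Fin d → ℝ} (hu : ∀ i, u i ≤ 1)
    (hv : ∀ i, v i ≤ 1) :
    GammaHatD u v - GammaD u v =
      -∑ k, piDot u k * piDot v k * (min (u k) (v k) - u k * v k) := by
  have hleft : ∑ k, piDot u k * GammaD (hatVec u k) v =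
      ∑ k, piDot u k * piDot v k * (min (u k) (v k) - u k * v k) :=
    Finset.sum_congr rfl fun k _ => by rw [GammaD_hatVec_left u hv, mul_assoc]
  have hright : ∑ k, piDot v k * GammaD u (hatVec v k) =
      ∑ k, piDot u k * piDot v k * (min (u k) (v k) - u k * v k) :=
    Finset.sum_congr rfl fun k _ => by
      rw [GammaD_comm, GammaD_hatVec_left v hu, min_comm]
      ring
  have hboth : ∑ k, ∑ l, piDot u k * piDot v l * GammaD (hatVec u k) (hatVec v l) =
      ∑ k, piDot u k * piDot v k * (min (u k) (v k) - u k * v k) := by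
    simp [GammaD_hatVec_hatVec hu hv]
  rw [GammaHatD, hleft, hright, hboth]
  ring

/-- **Proposition 4 (Genest–Segers).** For the `d`-variate pinned `π`-Brownian sheet, `d ≥ 2`,
and all `u, v ∈ (0,1]ᵈ`, the difference of the covariance functions is
`-piProd u * piProd v * ∑ k, (min (u k) (v k) - u k * v k)/(u k * v k)`, which is `≤ 0`. -/
theorem covariance_comparison_at_independence (d : ℕ) (hd : 2 ≤ d)
    (u v : Fin d → ℝ) (hu : ∀ i, u i ∈ Ioc (0:ℝ) 1) (hv : ∀ i, v i ∈ Ioc (0:ℝ) 1) :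
    GammaHatD u v - GammaD u v
        = - (piProd u * piProd v)
            * ∑ k, (min (u k) (v k) - u k * v k) / (u k * v k)
      ∧ GammaHatD u v ≤ GammaD u v := by
  have hdiff := GammaHatD_sub_GammaD (fun i => (hu i).2) (fun i => (hv i).2)
  constructor
  · rw [hdiff, neg_mul, Finset.mul_sum]
    congr 1
    refine Finset.sum_congr rfl fun k _ => ?_
    have huk := (hu k).1.ne'
    have hvk := (hv k).1.ne'
    rw [← mul_piDot u k, ← mul_piDot v k]
    field_simp
  · have hsum : 0 ≤ ∑ k, piDot u k * piDot v k * (min (u k) (v k) - u k * v k) := by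
      refine Finset.sum_nonneg fun k _ => mul_nonneg (mul_nonneg
        (piDot_nonneg (fun i => (hu i).1.le) k) (piDot_nonneg (fun i => (hv i).1.le) k)) ?_
      exact sub_nonneg.2 (le_min (mul_le_of_le_one_right (hu k).1.le (hv k).2)
        (mul_le_of_le_one_left (hv k).1.le (hu k).2))
    linarith
end

section
/- Let C be the independence copula C(u,v) = uv, for which Ċ₁(u,v) = v and Ċ₂(u,v) = u. Then for all u, v, s, t ∈ [0,1], Γ̂(u,v,s,t) − Γ(u,v,s,t) = 2uvst − us·(v∧t) − vt·(u∧s), and this quantity is ≤ 0. -/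
open Set

/-- At the independence copula `C(u,v) = u·v` (with partial derivatives `C1(u,v) = v` and
`C2(u,v) = u`), the difference of the two asymptotic covariance functions equals
`2uvst − us·(v ∧ t) − vt·(u ∧ s)`, which is nonpositive, for all `u,v,s,t ∈ [0,1]`. -/
theorem covariance_difference_at_independence :
    ∀ u ∈ Icc (0:ℝ) 1, ∀ v ∈ Icc (0:ℝ) 1, ∀ s ∈ Icc (0:ℝ) 1, ∀ t ∈ Icc (0:ℝ) 1,
      GammaHat (fun x y => x * y) (fun _ y => y) (fun x _ => x) u v s t
          - Gamma (fun x y => x * y) u v s t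
        = 2 * u * v * s * t - u * s * min v t - v * t * min u s
      ∧ 2 * u * v * s * t - u * s * min v t - v * t * min u s ≤ 0 := by
  rintro u ⟨hu0, hu1⟩ v ⟨hv0, hv1⟩ s ⟨hs0, hs1⟩ t ⟨ht0, ht1⟩
  constructor
  · simp only [GammaHat, Gamma, min_self, min_eq_left hu1, min_eq_left hv1,
      min_eq_right hs1, min_eq_right ht1]
    ring
  · have hvt : v * t ≤ min v t :=
      le_min (mul_le_of_le_one_right hv0 ht1) (mul_le_of_le_one_left ht0 hv1)
    have hus : u * s ≤ min u s :=
      le_min (mul_le_of_le_one_right hu0 hs1) (mul_le_of_le_one_left hs0 hu1)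
    linarith [mul_le_mul_of_nonneg_left hvt (mul_nonneg hu0 hs0),
      mul_le_mul_of_nonneg_left hus (mul_nonneg hv0 ht0)]
end
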